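/- Let E be a complete real inner product space, n ≥ 1, and f₁,…,f_n : E → ℝ differentiable with L-Lipschitz gradients (L > 0); set F = (1/n)·Σ_j f_j. Fix an index i, α ∈ [0,1], points v̂, w, w₁,…,w_n ∈ E, and set v̄ = v̂ + (1−α)·(w_i − w). Let ζ_i ≥ 0 satisfy ‖∇F(x) − ∇f_i(x)‖² ≤ ζ_i for all x, and Γ ≥ 0 satisfy ‖∇F(x) − ∇F(y)‖² ≤ Γ for all x, y. Let (Ω, P) be a probability space, σ ≥ 0, and g : Ω → E Bochner integrable with mean ∫ g dP = α²·∇f_i(v̄) + (1−α)·(1/n)·Σ_j ∇f_j(w_j) and second central moment ∫ ‖g − ∫g dP‖² dP ≤ α⁴·σ² + (1−α)²·σ²/n. If 0 < η ≤ 1/L and the functions ω ↦ f_i(v̂ − η·g(ω)) and ω ↦ ‖g(ω)‖² are integrable, then ∫ f_i(v̂ − η·g(ω)) dP(ω) ≤ f_i(v̂) − (η/2)·‖∇f_i(v̂)‖² + (η²·L/2)·(α⁴·σ² + (1−α)²·σ²/n) + 2α⁴(1−α)²·η·L²·‖w_i − w‖² + (1−α)²·η·L²·(1/n)·Σ_j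 ‖w − w_j‖² + 4η·(1−α²)²·ζ_i + 8η·(1−α²)²·Γ + 8η·(α−α²)²·‖∇F(w)‖². -/

import Mathlib

open MeasureTheory

/-- The quadratic upper bound for a function with `L`-Lipschitz gradient. -/
theorem le_add_inner_add_of_lipschitz_gradient
    {E : Type*} [NormedAddCommGroup E] [InnerProductSpace ℝ E] [CompleteSpace E]
    {f : E → ℝ} {f' : E → E} {L : ℝ} (hf : ∀ x, HasGradientAt f (f' x) x)
    (hLip : ∀ x y, ‖f' x - f' y‖ ≤ L * ‖x - y‖) (x d : E) :
    f (x + d) ≤ f x + inner ℝ (f' x) d + L / 2 * ‖d‖ ^ 2 := by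
  have hderiv (t : ℝ) : HasDerivAt
      (fun t : ℝ => f (x + t • d) - t * inner ℝ (f' x) d - L / 2 * ‖d‖ ^ 2 * t ^ 2)
      (inner ℝ (f' (x + t • d)) d - inner ℝ (f' x) d - L * t * ‖d‖ ^ 2) t := by
    have hline : HasDerivAt (fun t : ℝ => x + t • d) d t := by
      simpa using ((hasDerivAt_id t).smul_const d).const_add x
    have hcomp : HasDerivAt (fun t : ℝ => f (x + t • d)) (inner ℝ (f' (x + t • d)) d) t := by
      exact (hf (x + t • d)).hasFDerivAt.comp_hasDerivAt t hline
    refine ((hcomp.sub ((hasDerivAt_id t).mul_const (inner ℝ (f' x) d))).sub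
      ((hasDerivAt_pow 2 t).const_mul (L / 2 * ‖d‖ ^ 2))).congr_deriv ?_
    norm_num
    ring
  have hanti := antitoneOn_of_deriv_nonpos (convex_Icc (0 : ℝ) 1)
    (fun t _ => (hderiv t).continuousAt.continuousWithinAt)
    (fun t _ => (hderiv t).differentiableAt.differentiableWithinAt) (fun t ht => by
      rw [interior_Icc] at ht
      rw [(hderiv t).deriv, ← inner_sub_left]
      have hnorm := hLip (x + t • d) x
      rw [add_sub_cancel_left, norm_smul, Real.norm_of_nonneg ht.1.le] at hnorm
      have hinner := real_inner_le_norm (f' (x + t • d) - f' x) d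
      nlinarith [mul_le_mul_of_nonneg_right hnorm (norm_nonneg d)])
  have h01 := hanti (Set.left_mem_Icc.2 zero_le_one) (Set.right_mem_Icc.2 zero_le_one) zero_le_one
  norm_num at h01
  linarith

theorem norm_add_sq_le_two_mul {E : Type*} [SeminormedAddCommGroup E] (x y : E) :
    ‖x + y‖ ^ 2 ≤ 2 * ‖x‖ ^ 2 + 2 * ‖y‖ ^ 2 := by
  nlinarith [norm_add_le x y, norm_nonneg (x + y), sq_nonneg (‖x‖ - ‖y‖)]

/-- The squared norm of an average is at most the average of the squared norms. -/
theorem norm_average_sq_le {E : Type*} [SeminormedAddCommGroup E] [NormedSpace ℝ E]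
    {n : ℕ} (u : Fin n → E) :
    ‖(1 / (n : ℝ)) • ∑ j, u j‖ ^ 2 ≤ (1 / (n : ℝ)) * ∑ j, ‖u j‖ ^ 2 := by
  rcases n.eq_zero_or_pos with rfl | hn
  · simp
  have hn' : (0 : ℝ) < n := by exact_mod_cast hn
  have hcs : ‖∑ j, u j‖ ^ 2 ≤ n * ∑ j, ‖u j‖ ^ 2 := by
    have hsum := sq_sum_le_card_mul_sum_sq (s := Finset.univ) (f := fun j => ‖u j‖)
    rw [Finset.card_univ, Fintype.card_fin] at hsum
    exact (pow_le_pow_left₀ (norm_nonneg _) (norm_sum_le _ _) 2).trans hsum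
  rw [norm_smul, Real.norm_of_nonneg (by positivity), mul_pow]
  calc (1 / (n : ℝ)) ^ 2 * ‖∑ j, u j‖ ^ 2
      ≤ (1 / (n : ℝ)) ^ 2 * (n * ∑ j, ‖u j‖ ^ 2) := by gcongr
    _ = (1 / (n : ℝ)) * ∑ j, ‖u j‖ ^ 2 := by field_simp

/-- One stochastic gradient step with a possibly biased direction `g`: for step sizes at most `1/L`,
the expected value decreases up to the variance and the squared bias of `g`. -/
theorem integral_gradient_step_le
    {E : Type*} [NormedAddCommGroup E] [InnerProductSpace ℝ E] [CompleteSpace E]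
    {f : E → ℝ} {f' : E → E} {L : ℝ} (hL : 0 < L) (hf : ∀ x, HasGradientAt f (f' x) x)
    (hLip : ∀ x y, ‖f' x - f' y‖ ≤ L * ‖x - y‖)
    {Ω : Type*} [MeasurableSpace Ω] (P : Measure Ω) [IsProbabilityMeasure P]
    {g : Ω → E} (hg : Integrable g P) (hg2 : Integrable (fun ω => ‖g ω‖ ^ 2) P)
    {η : ℝ} (hη0 : 0 < η) (hη1 : η ≤ 1 / L) (x : E)
    (hfint : Integrable (fun ω => f (x - η • g ω)) P) :
    ∫ ω, f (x - η • g ω) ∂P ≤ f x - η / 2 * ‖f' x‖ ^ 2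
      + η ^ 2 * L / 2 * ∫ ω, ‖g ω - ∫ ω', g ω' ∂P‖ ^ 2 ∂P
      + η / 2 * ‖f' x - ∫ ω, g ω ∂P‖ ^ 2 := by
  set m := ∫ ω, g ω ∂P
  have hinner (c : E) : ∫ ω, inner ℝ c (g ω) ∂P = inner ℝ c m := integral_inner hg c
  have hvar : ∫ ω, ‖g ω - m‖ ^ 2 ∂P = (∫ ω, ‖g ω‖ ^ 2 ∂P) - ‖m‖ ^ 2 := by
    have hexp (ω : Ω) : ‖g ω - m‖ ^ 2 = ‖g ω‖ ^ 2 - 2 * inner ℝ m (g ω) + ‖m‖ ^ 2 := by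
      rw [norm_sub_sq_real, real_inner_comm]
    have hi : Integrable (fun ω => 2 * inner ℝ m (g ω)) P := (hg.const_inner m).const_mul 2
    have hs : Integrable (fun ω => ‖g ω‖ ^ 2 - 2 * inner ℝ m (g ω)) P := hg2.sub hi
    simp_rw [hexp]
    rw [integral_add hs (integrable_const _), integral_sub hg2 hi,
      integral_const_mul, hinner, real_inner_self_eq_norm_sq]
    simp
    ring
  have hi : Integrable (fun ω => η * inner ℝ (f' x) (g ω)) P := (hg.const_inner _).const_mul η
  have hq : Integrable (fun ω => η ^ 2 * L / 2 * ‖g ω‖ ^ 2) P := hg2.const_mul _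
  have hs : Integrable (fun ω => f x - η * inner ℝ (f' x) (g ω)) P := (integrable_const _).sub hi
  have hstep : ∫ ω, f (x - η • g ω) ∂P
      ≤ ∫ ω, (f x - η * inner ℝ (f' x) (g ω) + η ^ 2 * L / 2 * ‖g ω‖ ^ 2) ∂P := by
    refine integral_mono hfint (hs.add hq) fun ω => ?_
    have h := le_add_inner_add_of_lipschitz_gradient hf hLip x (-(η • g ω))
    rw [← sub_eq_add_neg, inner_neg_right, real_inner_smul_right, norm_neg, norm_smul,
      mul_pow, Real.norm_eq_abs, sq_abs] at h
    dsimp only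
    linarith
  rw [integral_add hs hq, integral_sub (integrable_const _) hi,
    integral_const_mul, integral_const_mul, hinner, integral_const, probReal_univ, one_smul]
    at hstep
  have hηL : η ^ 2 * L ≤ η := by
    rw [le_div_iff₀ hL] at hη1
    nlinarith
  rw [hvar, norm_sub_sq_real]
  nlinarith [mul_le_mul_of_nonneg_right hηL (sq_nonneg ‖m‖)]

theorem gradient_average_eq
    {E : Type*} [NormedAddCommGroup E] [InnerProductSpace ℝ E] [CompleteSpace E]
    {n : ℕ} {f : Fin n → E → ℝ} {u : Fin n → E} {v x : E}
    (hf : ∀ j, HasGradientAt (f j) (u j) x)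
    (hv : HasGradientAt (fun z => (1 / (n : ℝ)) * ∑ j, f j z) v x) :
    v = (1 / (n : ℝ)) • ∑ j, u j := by
  refine hv.unique ?_
  rw [hasGradientAt_iff_hasFDerivAt]
  refine ((HasFDerivAt.fun_sum (u := Finset.univ) fun j _ => (hf j).hasFDerivAt).const_mul
    (1 / (n : ℝ))).congr_fderiv ?_
  rw [map_smul, map_sum]

/-- descent lemma for the personalized model update in APFL (nonconvex case).
`v̂` is client `i`'s personalized model mixed with the averaged global model `w`,
`v̄ = v̂ + (1−α)·(w_i − w)` the one mixed with client `i`'s local copy `w_i`, and `g` the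
stochastic update direction, unbiased for `α²·∇f_i(v̄) + (1−α)·(1/n)·Σ_j ∇f_j(w_j)` with
variance at most `α⁴σ² + (1−α)²σ²/n`. One step `v̂ − η·g` decreases `f_i` in expectation
up to variance, deviation, gradient-diversity (`ζ_i`), and gradient-discrepancy (`Γ`) terms. -/
theorem personalized_descent_step
    {E : Type*} [NormedAddCommGroup E] [InnerProductSpace ℝ E] [CompleteSpace E]
    (n : ℕ) (hn : 1 ≤ n) (f : Fin n → E → ℝ) (gf : Fin n → E → E)
    (L : ℝ) (hL : 0 < L)
    (hgf : ∀ j x, HasGradientAt (f j) (gf j x) x)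
    (hLip : ∀ j x y, ‖gf j x - gf j y‖ ≤ L * ‖x - y‖)
    (F : E → ℝ) (hF : F = fun z => (1 / (n : ℝ)) * ∑ j, f j z)
    (gF : E → E) (hgF : ∀ x, HasGradientAt F (gF x) x)
    (i : Fin n) (α : ℝ) (hα0 : 0 ≤ α) (hα1 : α ≤ 1)
    (vhat w : E) (ws : Fin n → E)
    (ζi : ℝ) (hζi0 : 0 ≤ ζi) (hζi : ∀ x, ‖gF x - gf i x‖ ^ 2 ≤ ζi)
    (Γ : ℝ) (hΓ0 : 0 ≤ Γ) (hΓ : ∀ x y, ‖gF x - gF y‖ ^ 2 ≤ Γ)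
    {Ω : Type*} [MeasurableSpace Ω] (P : Measure Ω) [IsProbabilityMeasure P]
    (σ : ℝ) (hσ : 0 ≤ σ) (g : Ω → E) (hgint : Integrable g P)
    (hmean : ∫ ω, g ω ∂P
      = α ^ 2 • gf i (vhat + (1 - α) • (ws i - w))
          + ((1 - α) / (n : ℝ)) • ∑ j, gf j (ws j))
    (hvar : ∫ ω, ‖g ω - ∫ ω', g ω' ∂P‖ ^ 2 ∂P
      ≤ α ^ 4 * σ ^ 2 + (1 - α) ^ 2 * σ ^ 2 / (n : ℝ))
    (η : ℝ) (hη0 : 0 < η) (hη1 : η ≤ 1 / L)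
    (hfint : Integrable (fun ω => f i (vhat - η • g ω)) P)
    (hg2int : Integrable (fun ω => ‖g ω‖ ^ 2) P) :
    ∫ ω, f i (vhat - η • g ω) ∂P
      ≤ f i vhat - (η / 2) * ‖gf i vhat‖ ^ 2
        + (η ^ 2 * L / 2) * (α ^ 4 * σ ^ 2 + (1 - α) ^ 2 * σ ^ 2 / (n : ℝ))
        + 2 * α ^ 4 * (1 - α) ^ 2 * η * L ^ 2 * ‖ws i - w‖ ^ 2
        + (1 - α) ^ 2 * η * L ^ 2 * ((1 / (n : ℝ)) * ∑ j, ‖w - ws j‖ ^ 2)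
        + 4 * η * (1 - α ^ 2) ^ 2 * ζi + 8 * η * (1 - α ^ 2) ^ 2 * Γ
        + 8 * η * (α - α ^ 2) ^ 2 * ‖gF w‖ ^ 2 := by
  have hstep := integral_gradient_step_le hL (hgf i) (hLip i) P hgint hg2int hη0 hη1 vhat hfint
  set V := (1 / (n : ℝ)) * ∑ j, ‖w - ws j‖ ^ 2 with hV
  set vbar := vhat + (1 - α) • (ws i - w) with hvbar
  set avg := (1 / (n : ℝ)) • ∑ j, gf j (ws j) with havg
  have hlocal : ‖α ^ 2 • (gf i vhat - gf i vbar)‖ ^ 2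
      ≤ α ^ 4 * (1 - α) ^ 2 * L ^ 2 * ‖ws i - w‖ ^ 2 := by
    have h := hLip i vhat vbar
    rw [hvbar, sub_add_cancel_left, norm_neg, norm_smul,
      Real.norm_of_nonneg (sub_nonneg.2 hα1)] at h
    rw [norm_smul, Real.norm_of_nonneg (sq_nonneg α)]
    calc (α ^ 2 * ‖gf i vhat - gf i vbar‖) ^ 2
        ≤ (α ^ 2 * (L * ((1 - α) * ‖ws i - w‖))) ^ 2 := by gcongr
      _ = _ := by ring
  have hglobal : ‖(1 - α) • (gF w - avg)‖ ^ 2 ≤ (1 - α) ^ 2 * L ^ 2 * V := by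
    have hFw : gF w = (1 / (n : ℝ)) • ∑ j, gf j w :=
      gradient_average_eq (fun j => hgf j w) (hF ▸ hgF w)
    rw [norm_smul, mul_pow, Real.norm_eq_abs, sq_abs, mul_assoc, hFw, havg, ← smul_sub,
      ← Finset.sum_sub_distrib]
    refine mul_le_mul_of_nonneg_left ((norm_average_sq_le _).trans ?_) (sq_nonneg _)
    rw [hV, mul_left_comm, Finset.mul_sum _ _ (L ^ 2)]
    gcongr with j
    rw [← mul_pow]
    exact pow_le_pow_left₀ (norm_nonneg _) (hLip j w (ws j)) 2
  have hdiversity : ‖(1 - α ^ 2) • (gf i vhat - gF vhat)‖ ^ 2 ≤ (1 - α ^ 2) ^ 2 * ζi := by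
    rw [norm_smul, mul_pow, Real.norm_eq_abs, sq_abs, norm_sub_rev]
    exact mul_le_mul_of_nonneg_left (hζi vhat) (sq_nonneg _)
  have hdiscrepancy : ‖(1 - α ^ 2) • (gF vhat - gF w)‖ ^ 2 ≤ (1 - α ^ 2) ^ 2 * Γ := by
    rw [norm_smul, mul_pow, Real.norm_eq_abs, sq_abs]
    exact mul_le_mul_of_nonneg_left (hΓ vhat w) (sq_nonneg _)
  have hresidual : ‖(α - α ^ 2) • gF w‖ ^ 2 = (α - α ^ 2) ^ 2 * ‖gF w‖ ^ 2 := by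
    rw [norm_smul, mul_pow, Real.norm_eq_abs, sq_abs]
  have hdecomp : gf i vhat - ∫ ω, g ω ∂P
      = (α ^ 2 • (gf i vhat - gf i vbar) + ((1 - α ^ 2) • (gf i vhat - gF vhat)
          + ((1 - α ^ 2) • (gF vhat - gF w) + (α - α ^ 2) • gF w)))
        + (1 - α) • (gF w - avg) := by
    rw [hmean, div_eq_mul_one_div, mul_smul, ← havg]
    module
  have hbias : ‖gf i vhat - ∫ ω, g ω ∂P‖ ^ 2
      ≤ 4 * (α ^ 4 * (1 - α) ^ 2 * L ^ 2 * ‖ws i - w‖ ^ 2) + 2 * ((1 - α) ^ 2 * L ^ 2 * V)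
        + 8 * ((1 - α ^ 2) ^ 2 * ζi) + 16 * ((1 - α ^ 2) ^ 2 * Γ)
        + 16 * ((α - α ^ 2) ^ 2 * ‖gF w‖ ^ 2) := by
    rw [hdecomp]
    linarith [norm_add_sq_le_two_mul (α ^ 2 • (gf i vhat - gf i vbar)
        + ((1 - α ^ 2) • (gf i vhat - gF vhat)
          + ((1 - α ^ 2) • (gF vhat - gF w) + (α - α ^ 2) • gF w))) ((1 - α) • (gF w - avg)),
      norm_add_sq_le_two_mul (α ^ 2 • (gf i vhat - gf i vbar))
        ((1 - α ^ 2) • (gf i vhat - gF vhat)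
          + ((1 - α ^ 2) • (gF vhat - gF w) + (α - α ^ 2) • gF w)),
      norm_add_sq_le_two_mul ((1 - α ^ 2) • (gf i vhat - gF vhat))
        ((1 - α ^ 2) • (gF vhat - gF w) + (α - α ^ 2) • gF w),
      norm_add_sq_le_two_mul ((1 - α ^ 2) • (gF vhat - gF w)) ((α - α ^ 2) • gF w)]
  have hvar' := mul_le_mul_of_nonneg_left hvar (show 0 ≤ η ^ 2 * L / 2 by positivity)
  have hbias' := mul_le_mul_of_nonneg_left hbias (show 0 ≤ η / 2 by positivity)
  linarith
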